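/- arXiv:math/9806135 — 5 statements merged into one kernel-verified Lean document; each statement's English description precedes it below -/
import Mathlib

section
/- Let I ⊆ ℝ be a nonempty open interval and let φ, ψ : ℝ → ℝ be smooth functions with φ'(t) > 0 and ψ'(t) > 0 for all t ∈ I. If S(φ)(t) = S(ψ)(t) for all t ∈ I, then there exist real numbers a, b, c, d with a·d − b·c ≠ 0 such that for all t ∈ I one has c·φ(t) + d ≠ 0 and ψ(t) = (a·φ(t) + b)/(c·φ(t) + d). -/
/-- The Schwarzian derivative of `f` at `t`. -/
noncomputable def schwarzian (f : ℝ → ℝ) (t : ℝ) : ℝ :=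
  deriv (deriv (deriv f)) t / deriv f t
    - (3 / 2) * (deriv (deriv f) t / deriv f t) ^ 2

theorem exists_eq_const_of_hasDerivAt_zero {I : Set ℝ} (hI : IsOpen I)
    (hIconn : I.OrdConnected) {f : ℝ → ℝ} (hf : ∀ t ∈ I, HasDerivAt f 0 t) :
    ∃ k, ∀ t ∈ I, f t = k :=
  hI.exists_is_const_of_deriv_eq_zero hIconn.isPreconnected
    (fun t ht => (hf t ht).differentiableAt.differentiableWithinAt) fun t ht => (hf t ht).deriv

/-- On an interval where `w > 0`, `w' = c φ'` and `ψ' = φ' / w²`, the function `ψ` is a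
homography of `φ`. -/
theorem exists_homography_of_deriv_eq_div_sq {I : Set ℝ} (hI : IsOpen I)
    (hIconn : I.OrdConnected) (hIne : I.Nonempty) {φ ψ φ₁ w : ℝ → ℝ} {c : ℝ}
    (hφ : ∀ t ∈ I, HasDerivAt φ (φ₁ t) t) (hw₀ : ∀ t ∈ I, 0 < w t)
    (hw : ∀ t ∈ I, HasDerivAt w (c * φ₁ t) t)
    (hψ : ∀ t ∈ I, HasDerivAt ψ (φ₁ t / w t ^ 2) t) :
    ∃ a b c d : ℝ, a * d - b * c ≠ 0 ∧
      ∀ t ∈ I, c * φ t + d ≠ 0 ∧ ψ t = (a * φ t + b) / (c * φ t + d) := by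
  obtain ⟨d, hd⟩ := exists_eq_const_of_hasDerivAt_zero hI hIconn
    (f := fun t => w t - c * φ t) fun t ht => by
      simpa using (hw t ht).fun_sub ((hφ t ht).const_mul c)
  obtain ⟨a, ha⟩ := exists_eq_const_of_hasDerivAt_zero hI hIconn
    (f := fun t => (w t)⁻¹ + c * ψ t) fun t ht => by
      refine (((hw t ht).fun_inv (hw₀ t ht).ne').fun_add ((hψ t ht).const_mul c)).congr_deriv ?_
      ring
  obtain ⟨b, hb⟩ := exists_eq_const_of_hasDerivAt_zero hI hIconn
    (f := fun t => ψ t * w t - a * φ t) fun t ht => by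
      refine (((hψ t ht).fun_mul (hw t ht)).fun_sub ((hφ t ht).const_mul a)).congr_deriv ?_
      have := (hw₀ t ht).ne'
      rw [← ha t ht]
      field_simp
      ring
  refine ⟨a, b, c, d, ?_, fun t ht => ?_⟩
  · obtain ⟨t, ht⟩ := hIne
    have := (hw₀ t ht).ne'
    have hdet : a * d - b * c = 1 := by
      rw [← hb t ht, ← hd t ht, ← ha t ht]
      field_simp
      ring
    simp [hdet]
  · have hden : c * φ t + d = w t := by linear_combination -hd t ht
    have hw_ne := (hw₀ t ht).ne'
    rw [hden, eq_div_iff hw_ne]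
    exact ⟨hw_ne, by linear_combination hb t ht⟩

/-- If two smooth functions with positive derivative on a nonempty open interval `I`
have the same Schwarzian derivative on `I`, then they differ by a homography:
`ψ = (a·φ + b)/(c·φ + d)` with `a·d − b·c ≠ 0`. -/
theorem eq_schwarzian_implies_homography
    (I : Set ℝ) (hI : IsOpen I) (hIconn : I.OrdConnected) (hIne : I.Nonempty)
    (φ ψ : ℝ → ℝ) (hφ : ContDiff ℝ (⊤ : ℕ∞) φ) (hψ : ContDiff ℝ (⊤ : ℕ∞) ψ)
    (hφ' : ∀ t ∈ I, 0 < deriv φ t) (hψ' : ∀ t ∈ I, 0 < deriv ψ t)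
    (hS : ∀ t ∈ I, schwarzian φ t = schwarzian ψ t) :
    ∃ a b c d : ℝ, a * d - b * c ≠ 0 ∧
      ∀ t ∈ I, c * φ t + d ≠ 0 ∧ ψ t = (a * φ t + b) / (c * φ t + d) := by
  have deriv_smooth : ∀ {f : ℝ → ℝ}, ContDiff ℝ (⊤ : ℕ∞) f → ContDiff ℝ (⊤ : ℕ∞) (deriv f) :=
    fun hf => (contDiff_infty_iff_deriv.1 hf).2
  have hasDeriv : ∀ {f : ℝ → ℝ}, ContDiff ℝ (⊤ : ℕ∞) f → ∀ t, HasDerivAt f (deriv f t) t :=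
    fun hf t => ((contDiff_infty_iff_deriv.1 hf).1 t).hasDerivAt
  have hφ₁ := hasDeriv (deriv_smooth hφ)
  have hψ₁ := hasDeriv (deriv_smooth hψ)
  have hφ₂ := hasDeriv (deriv_smooth (deriv_smooth hφ))
  have hψ₂ := hasDeriv (deriv_smooth (deriv_smooth hψ))
  set w : ℝ → ℝ := fun t => √(deriv φ t / deriv ψ t)
  have hw₀ : ∀ t ∈ I, 0 < w t := fun t ht => Real.sqrt_pos.2 (div_pos (hφ' t ht) (hψ' t ht))
  have hw_sq : ∀ t ∈ I, w t ^ 2 = deriv φ t / deriv ψ t := fun t ht =>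
    Real.sq_sqrt (div_pos (hφ' t ht) (hψ' t ht)).le
  have hw : ∀ t ∈ I, HasDerivAt w
      (w t * (deriv (deriv φ) t / deriv φ t - deriv (deriv ψ) t / deriv ψ t) / 2) t := by
    intro t ht
    have hφ_ne := (hφ' t ht).ne'
    have hψ_ne := (hψ' t ht).ne'
    have hw_ne := (hw₀ t ht).ne'
    refine (((hφ₁ t).fun_div (hψ₁ t) hψ_ne).sqrt (div_pos (hφ' t ht) (hψ' t ht)).ne').congr_deriv ?_
    change _ / (2 * w t) = _
    have hsq : deriv φ t = w t ^ 2 * deriv ψ t := by rw [hw_sq t ht]; field_simp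
    rw [hsq]
    field_simp
  obtain ⟨c, hc⟩ := exists_eq_const_of_hasDerivAt_zero hI hIconn
    (f := fun t => w t * (deriv (deriv φ) t / deriv φ t - deriv (deriv ψ) t / deriv ψ t) / 2
      / deriv φ t) fun t ht => by
      have hφ_ne := (hφ' t ht).ne'
      have hψ_ne := (hψ' t ht).ne'
      refine ((((hw t ht).fun_mul (((hφ₂ t).fun_div (hφ₁ t) hφ_ne).fun_sub
        ((hψ₂ t).fun_div (hψ₁ t) hψ_ne))).div_const 2).fun_div (hφ₁ t) hφ_ne).congr_deriv ?_
      have hSt := hS t ht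
      unfold schwarzian at hSt
      trans w t / (2 * deriv φ t) *
        ((deriv (deriv (deriv φ)) t / deriv φ t - 3 / 2 * (deriv (deriv φ) t / deriv φ t) ^ 2) -
        (deriv (deriv (deriv ψ)) t / deriv ψ t - 3 / 2 * (deriv (deriv ψ) t / deriv ψ t) ^ 2))
      · field_simp
        ring
      · rw [hSt, sub_self, mul_zero]
  refine exists_homography_of_deriv_eq_div_sq hI hIconn hIne (φ₁ := deriv φ) (w := w) (c := c)
    (fun t _ => hasDeriv hφ t) hw₀ (fun t ht => (hw t ht).congr_deriv ?_)
    fun t ht => (hasDeriv hψ t).congr_deriv ?_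
  · rw [← hc t ht, div_mul_cancel₀ _ (hφ' t ht).ne']
  · rw [hw_sq t ht, div_div_cancel₀ (hφ' t ht).ne']
end

section
/- Let I ⊆ ℝ be a nonempty open interval and let φ : ℝ → ℝ be a smooth function with φ'(t) ≠ 0 for all t ∈ I. If S(φ)(t) = 0 for all t ∈ I, then there exist real numbers a, b, c, d with a·d − b·c ≠ 0 such that for all t ∈ I one has c·t + d ≠ 0 and φ(t) = (a·t + b)/(c·t + d). -/
theorem eq_of_hasDerivAt_zero {I : Set ℝ} (hI : IsOpen I) (hIconn : I.OrdConnected)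
    {f : ℝ → ℝ} (hf : ∀ t ∈ I, HasDerivAt f 0 t) {s t : ℝ} (hs : s ∈ I) (ht : t ∈ I) :
    f s = f t :=
  hI.is_const_of_deriv_eq_zero hIconn.isPreconnected
    (fun x hx => (hf x hx).differentiableAt.differentiableWithinAt)
    (fun x hx => (hf x hx).deriv) hs ht

theorem two_mul_deriv_mul_eq_of_schwarzian_eq_zero {f : ℝ → ℝ} {t : ℝ}
    (hf : deriv f t ≠ 0) (hS : schwarzian f t = 0) :
    2 * deriv f t * deriv (deriv (deriv f)) t = 3 * deriv (deriv f) t ^ 2 := by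
  unfold schwarzian at hS
  field_simp at hS
  linarith

/-- A smooth function with nonvanishing derivative and vanishing Schwarzian derivative
on a nonempty open interval `I` is the restriction to `I` of a homography
`t ↦ (a·t + b)/(c·t + d)` with `a·d − b·c ≠ 0`. -/
theorem schwarzian_eq_zero_implies_homography
    (I : Set ℝ) (hI : IsOpen I) (hIconn : I.OrdConnected) (hIne : I.Nonempty)
    (φ : ℝ → ℝ) (hφ : ContDiff ℝ (⊤ : ℕ∞) φ)
    (hφ' : ∀ t ∈ I, deriv φ t ≠ 0)
    (hS : ∀ t ∈ I, schwarzian φ t = 0) :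
    ∃ a b c d : ℝ, a * d - b * c ≠ 0 ∧
      ∀ t ∈ I, c * t + d ≠ 0 ∧ φ t = (a * t + b) / (c * t + d) := by
  obtain ⟨t₀, ht₀⟩ := hIne
  have hd1 : ContDiff ℝ (⊤ : ℕ∞) (deriv φ) := (contDiff_infty_iff_deriv.1 hφ).2
  have hd2 : ContDiff ℝ (⊤ : ℕ∞) (deriv (deriv φ)) := (contDiff_infty_iff_deriv.1 hd1).2
  have h1 (t : ℝ) : HasDerivAt φ (deriv φ t) t :=
    ((contDiff_infty_iff_deriv.1 hφ).1 t).hasDerivAt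
  have h2 (t : ℝ) : HasDerivAt (deriv φ) (deriv (deriv φ) t) t :=
    ((contDiff_infty_iff_deriv.1 hd1).1 t).hasDerivAt
  have h3 (t : ℝ) : HasDerivAt (deriv (deriv φ)) (deriv (deriv (deriv φ)) t) t :=
    ((contDiff_infty_iff_deriv.1 hd2).1 t).hasDerivAt
  have hode (t : ℝ) (ht : t ∈ I) :=
    two_mul_deriv_mul_eq_of_schwarzian_eq_zero (hφ' t ht) (hS t ht)
  have hu₀ := hφ' t₀ ht₀
  set u := deriv φ
  set v := deriv u
  set w := deriv v
  obtain ⟨c, hc⟩ : ∃ c, v t₀ = -2 * c * u t₀ := ⟨-(v t₀ / u t₀) / 2, by field_simp⟩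
  have hL (t : ℝ) : HasDerivAt (fun s => 1 + c * (s - t₀)) c t := by
    simpa using (((hasDerivAt_id t).sub_const t₀).const_mul c).const_add 1
  have hg (t : ℝ) (ht : t ∈ I) : v t * (1 + c * (t - t₀)) + 2 * c * u t = 0 := by
    have hconst := eq_of_hasDerivAt_zero hI hIconn
      (f := fun s => (v s * (1 + c * (s - t₀)) + 2 * c * u s) ^ 2 / u s ^ 3)
      (fun s hs => by
        have hus := hφ' s hs
        refine (((((h3 s).mul (hL s)).add ((h2 s).const_mul (2 * c))).pow 2).div
          ((h2 s).pow 3) (pow_ne_zero 3 hus)).congr_deriv ?_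
        rw [div_eq_zero_iff]
        left
        simp only [Pi.add_apply, Pi.mul_apply, Pi.pow_apply]
        push_cast
        linear_combination u s ^ 2 * (v s * (1 + c * (s - t₀)) + 2 * c * u s) *
          (1 + c * (s - t₀)) * hode s hs) ht ht₀
    have hz : v t₀ + 2 * c * u t₀ = 0 := by rw [hc]; ring
    simpa [hz, hφ' t ht] using hconst
  have hf' (t : ℝ) (ht : t ∈ I) :
      u t * (1 + c * (t - t₀)) + (φ t - φ t₀) * c - u t₀ = 0 := by
    have hconst := eq_of_hasDerivAt_zero hI hIconn
      (f := fun s => u s * (1 + c * (s - t₀)) + (φ s - φ t₀) * c - u t₀)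
      (fun s hs => ((((h2 s).mul (hL s)).add (((h1 s).sub_const _).mul_const c)).sub_const
        _).congr_deriv (by linear_combination hg s hs)) ht ht₀
    simpa using hconst
  have hf (t : ℝ) (ht : t ∈ I) :
      (φ t - φ t₀) * (1 + c * (t - t₀)) - u t₀ * (t - t₀) = 0 := by
    have hconst := eq_of_hasDerivAt_zero hI hIconn
      (f := fun s => (φ s - φ t₀) * (1 + c * (s - t₀)) - u t₀ * (s - t₀))
      (fun s hs => ((((h1 s).sub_const _).mul (hL s)).sub
        (((hasDerivAt_id s).sub_const t₀).const_mul (u t₀))).congr_deriv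
          (by linear_combination hf' s hs)) ht ht₀
    simpa using hconst
  refine ⟨φ t₀ * c + u t₀, φ t₀ * (1 - c * t₀) - u t₀ * t₀, c, 1 - c * t₀, ?_, fun t ht => ?_⟩
  · convert hu₀ using 1
    ring
  · have hne : c * t + (1 - c * t₀) ≠ 0 := by
      intro h0
      have hL0 : 1 + c * (t - t₀) = 0 := by linear_combination h0
      have hc0 : c = 0 := by simpa [hL0, hφ' t ht] using hg t ht
      simp [hc0] at hL0
    exact ⟨hne, (eq_div_iff hne).2 (by linear_combination hf t ht)⟩
end

section
/- Let t₀, y₀, y₁, y₂ ∈ ℝ with y₁ ≠ 0. Then there exist real numbers a, b, c, d with a·d − b·c ≠ 0 and c·t₀ + d ≠ 0 such that the homography h(t) = (a·t + b)/(c·t + d) satisfies h(t₀) = y₀, h'(t₀) = y₁ and h''(t₀) = y₂. Moreover this homography is unique: any two quadruples (a,b,c,d) and (a',b',c',d') with these properties are proportional, i.e. there is λ ≠ 0 with (a',b',c',d') = λ·(a,b,c,d). -/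
theorem hasDerivAt_homography (a b c d : ℝ) {t : ℝ} (ht : c * t + d ≠ 0) :
    HasDerivAt (fun t => (a * t + b) / (c * t + d)) ((a * d - b * c) / (c * t + d) ^ 2) t := by
  have hn : HasDerivAt (fun t => a * t + b) a t := by
    simpa using ((hasDerivAt_id t).const_mul a).add_const b
  have hd : HasDerivAt (fun t => c * t + d) c t := by
    simpa using ((hasDerivAt_id t).const_mul c).add_const d
  refine (hn.fun_div hd ht).congr_deriv ?_
  ring

theorem deriv_deriv_homography (a b c d : ℝ) {t : ℝ} (ht : c * t + d ≠ 0) :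
    deriv (deriv (fun t => (a * t + b) / (c * t + d))) t =
      -2 * c * (a * d - b * c) / (c * t + d) ^ 3 := by
  have hd : HasDerivAt (fun t => c * t + d) c t := by
    simpa using ((hasDerivAt_id t).const_mul c).add_const d
  have heq : deriv (fun t => (a * t + b) / (c * t + d)) =ᶠ[nhds t]
      fun t => (a * d - b * c) / (c * t + d) ^ 2 := by
    filter_upwards [hd.continuousAt.eventually_ne ht] with s hs
    exact (hasDerivAt_homography a b c d hs).deriv
  rw [heq.deriv_eq,
    ((hasDerivAt_const t (a * d - b * c)).fun_div (hd.fun_pow 2) (pow_ne_zero 2 ht)).deriv]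
  field_simp
  ring

/-- The coefficients of a homography are determined by its 2-jet at `t₀` and the value of its
denominator there. -/
theorem homography_coeff_eq {t₀ y₀ y₁ y₂ a b c d : ℝ} (hy₁ : y₁ ≠ 0) (hw : c * t₀ + d ≠ 0)
    (h₀ : (a * t₀ + b) / (c * t₀ + d) = y₀)
    (h₁ : deriv (fun t => (a * t + b) / (c * t + d)) t₀ = y₁)
    (h₂ : deriv (deriv (fun t => (a * t + b) / (c * t + d))) t₀ = y₂) :
    c = -y₂ / (2 * y₁) * (c * t₀ + d) ∧ a = (y₁ - y₂ / (2 * y₁) * y₀) * (c * t₀ + d) := by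
  rw [(hasDerivAt_homography a b c d hw).deriv] at h₁
  rw [deriv_deriv_homography a b c d hw] at h₂
  have hc : c = -y₂ / (2 * y₁) * (c * t₀ + d) := by
    have h : y₂ * (c * t₀ + d) = -2 * c * y₁ := by
      rw [← h₂, ← h₁]
      field_simp
    field_simp
    linarith
  have ha : a = y₁ * (c * t₀ + d) + c * y₀ := by
    rw [← h₁, ← h₀]
    field_simp
    ring
  refine ⟨hc, ?_⟩
  linear_combination ha + y₀ * hc


/-- Existence and uniqueness of the osculating homography: given `t₀` and prescribed
value `y₀`, first derivative `y₁ ≠ 0` and second derivative `y₂`, there is a homography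
`h(t) = (a·t + b)/(c·t + d)`, `a·d − b·c ≠ 0`, with `h(t₀) = y₀`, `h'(t₀) = y₁`,
`h''(t₀) = y₂`; and any two quadruples of coefficients with these properties are
proportional. -/
theorem osculating_homography_exists_unique
    (t₀ y₀ y₁ y₂ : ℝ) (hy₁ : y₁ ≠ 0) :
    (∃ a b c d : ℝ, a * d - b * c ≠ 0 ∧ c * t₀ + d ≠ 0 ∧
        (fun t => (a * t + b) / (c * t + d)) t₀ = y₀ ∧
        deriv (fun t => (a * t + b) / (c * t + d)) t₀ = y₁ ∧
        deriv (deriv (fun t => (a * t + b) / (c * t + d))) t₀ = y₂) ∧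
      ∀ a b c d a' b' c' d' : ℝ,
        (a * d - b * c ≠ 0 ∧ c * t₀ + d ≠ 0 ∧
          (fun t => (a * t + b) / (c * t + d)) t₀ = y₀ ∧
          deriv (fun t => (a * t + b) / (c * t + d)) t₀ = y₁ ∧
          deriv (deriv (fun t => (a * t + b) / (c * t + d))) t₀ = y₂) →
        (a' * d' - b' * c' ≠ 0 ∧ c' * t₀ + d' ≠ 0 ∧
          (fun t => (a' * t + b') / (c' * t + d')) t₀ = y₀ ∧
          deriv (fun t => (a' * t + b') / (c' * t + d')) t₀ = y₁ ∧
          deriv (deriv (fun t => (a' * t + b') / (c' * t + d'))) t₀ = y₂) →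
        ∃ lam : ℝ, lam ≠ 0 ∧ a' = lam * a ∧ b' = lam * b ∧ c' = lam * c ∧ d' = lam * d := by
  constructor
  · have hw : -y₂ / (2 * y₁) * t₀ + (1 + y₂ / (2 * y₁) * t₀) = 1 := by ring
    have hD : (y₁ - y₂ / (2 * y₁) * y₀) * (1 + y₂ / (2 * y₁) * t₀) -
        (y₀ - (y₁ - y₂ / (2 * y₁) * y₀) * t₀) * (-y₂ / (2 * y₁)) = y₁ := by ring
    have hw' : -y₂ / (2 * y₁) * t₀ + (1 + y₂ / (2 * y₁) * t₀) ≠ 0 := by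
      rw [hw]
      exact one_ne_zero
    refine ⟨y₁ - y₂ / (2 * y₁) * y₀, y₀ - (y₁ - y₂ / (2 * y₁) * y₀) * t₀, -y₂ / (2 * y₁),
      1 + y₂ / (2 * y₁) * t₀, by rwa [hD], hw', ?_, ?_, ?_⟩
    · beta_reduce
      rw [hw]
      ring
    · rw [(hasDerivAt_homography _ _ _ _ hw').deriv, hD, hw]
      ring
    · rw [deriv_deriv_homography _ _ _ _ hw', hD, hw]
      field_simp
  · rintro a b c d a' b' c' d' ⟨-, hw, h₀, h₁, h₂⟩ ⟨-, hw', h₀', h₁', h₂'⟩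
    beta_reduce at h₀ h₀'
    obtain ⟨hc, ha⟩ := homography_coeff_eq hy₁ hw h₀ h₁ h₂
    obtain ⟨hc', ha'⟩ := homography_coeff_eq hy₁ hw' h₀' h₁' h₂'
    rw [div_eq_iff hw] at h₀
    rw [div_eq_iff hw'] at h₀'
    obtain ⟨lam, hlam⟩ : ∃ lam, lam = (c' * t₀ + d') / (c * t₀ + d) := ⟨_, rfl⟩
    have hl : c' * t₀ + d' = lam * (c * t₀ + d) := by
      rw [hlam, div_mul_cancel₀ _ hw]
    have hcc : c' = lam * c := by
      linear_combination hc' - lam * hc + -y₂ / (2 * y₁) * hl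
    have haa : a' = lam * a := by
      linear_combination ha' - lam * ha + (y₁ - y₂ / (2 * y₁) * y₀) * hl
    refine ⟨lam, hlam ▸ div_ne_zero hw' hw, haa, ?_, hcc, ?_⟩
    · linear_combination h₀' - lam * h₀ + y₀ * hl - t₀ * haa
    · linear_combination hl - t₀ * hcc
end

section
/- There is no continuous 2π-periodic function q : ℝ → ℝ such that for every lift φ of an orientation-preserving diffeomorphism of the circle and every θ ∈ ℝ one has S̃(φ)(θ) = q(φ(θ))·φ'(θ)² − q(θ). In other words, the modified Schwarzian S̃ is a non-trivial 1-cocycle of Diff₊(𝕋) with values in the quadratic differentials of the circle. -/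
/-- The modified Schwarzian `S̃(f)(θ) = S(f)(θ) + (1/2)·(f'(θ)² − 1)`. -/
noncomputable def modifiedSchwarzian (f : ℝ → ℝ) (θ : ℝ) : ℝ :=
  schwarzian f θ + (1 / 2) * ((deriv f θ) ^ 2 - 1)

theorem deriv_id_add_mul_sin (a : ℝ) :
    deriv (fun t : ℝ => t + a * Real.sin t) = fun t => 1 + a * Real.cos t := by
  funext t
  exact ((hasDerivAt_id t).add ((Real.hasDerivAt_sin t).const_mul a)).deriv

theorem modifiedSchwarzian_id_add_mul_sin_zero (a : ℝ) :
    modifiedSchwarzian (fun t => t + a * Real.sin t) 0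
      = -a / (1 + a) + (1 / 2) * ((1 + a) ^ 2 - 1) := by
  simp [modifiedSchwarzian, schwarzian, deriv_id_add_mul_sin]

theorem deriv_id_add_mul_sin_pos {a : ℝ} (ha : |a| < 1) (t : ℝ) :
    0 < deriv (fun t : ℝ => t + a * Real.sin t) t := by
  rw [deriv_id_add_mul_sin]
  have h : |a * Real.cos t| < 1 := by
    rw [abs_mul]
    exact (mul_le_of_le_one_right (abs_nonneg a) (Real.abs_cos_le_one t)).trans_lt ha
  linarith [(abs_lt.mp h).1]

/-- The modified Schwarzian is a non-trivial 1-cocycle of `Diff₊(𝕋)` with values in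
the quadratic differentials of the circle: it is not the coboundary
`φ ↦ φ*q − q` of any continuous `2π`-periodic `q`. -/
theorem modifiedSchwarzian_not_coboundary :
    ¬ ∃ q : ℝ → ℝ, Continuous q ∧ (∀ θ, q (θ + 2 * Real.pi) = q θ) ∧
      ∀ φ : ℝ → ℝ, ContDiff ℝ (⊤ : ℕ∞) φ → (∀ θ, 0 < deriv φ θ) →
        (∀ θ, φ (θ + 2 * Real.pi) = φ θ + 2 * Real.pi) →
        ∀ θ : ℝ, modifiedSchwarzian φ θ = q (φ θ) * (deriv φ θ) ^ 2 - q θ := by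
  rintro ⟨q, -, -, hq⟩
  have key : ∀ a : ℝ, |a| < 1 →
      -a / (1 + a) + (1 / 2) * ((1 + a) ^ 2 - 1) = q 0 * (1 + a) ^ 2 - q 0 := by
    intro a ha
    have h := hq (fun t => t + a * Real.sin t)
      (contDiff_id.add (contDiff_const.mul Real.contDiff_sin)) (deriv_id_add_mul_sin_pos ha)
      (fun t => by simp only [Real.sin_add_two_pi]; ring) 0
    rw [modifiedSchwarzian_id_add_mul_sin_zero, deriv_id_add_mul_sin] at h
    simpa using h
  have h₁ := key (1 / 2) (by norm_num [abs_lt])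
  have h₂ := key (-1 / 2) (by norm_num [abs_lt])
  norm_num at h₁ h₂
  linarith
end

section
/- For lifts φ, ψ of orientation-preserving diffeomorphisms of the circle, define the Bott–Thurston cocycle BT(φ,ψ) = −(1/2)·∫₀^{2π} log((φ∘ψ)'(θ))·(ψ''(θ)/ψ'(θ)) dθ. Then for any three lifts φ₁, φ₂, φ₃ one has the group 2-cocycle identity BT(φ₁,φ₂) + BT(φ₁∘φ₂, φ₃) = BT(φ₂,φ₃) + BT(φ₁, φ₂∘φ₃). Equivalently, the multiplication law (φ₁,t₁)·(φ₂,t₂) = (φ₁∘φ₂, t₁ + t₂ + BT(φ₁,φ₂)) on pairs (lift, real number), defining the Virasoro group, is associative. -/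
/-- The Bott–Thurston cocycle
`BT(φ,ψ) = −(1/2)·∫₀^{2π} log((φ∘ψ)'(θ))·(ψ''(θ)/ψ'(θ)) dθ`. -/
noncomputable def bottThurston (φ ψ : ℝ → ℝ) : ℝ :=
  -(1 / 2) * ∫ θ in (0 : ℝ)..(2 * Real.pi),
    Real.log (deriv (φ ∘ ψ) θ) * (deriv (deriv ψ) θ / deriv ψ θ)

/-- The derivative of a function commuting with a translation is periodic. -/
theorem deriv_periodic_of_add {f : ℝ → ℝ} {c : ℝ} (h : ∀ x, f (x + c) = f x + c) :
    Function.Periodic (deriv f) c := by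
  intro x
  rw [← deriv_comp_add_const]
  simp [h]

/-- The derivative of a periodic function is periodic. -/
theorem Function.Periodic.deriv_real {f : ℝ → ℝ} {c : ℝ} (h : Function.Periodic f c) :
    Function.Periodic (deriv f) c := by
  intro x
  rw [← deriv_comp_add_const]
  simp [h _]

/-- Change of variables for a periodic function under the lift of a circle diffeomorphism. -/
theorem intervalIntegral_periodic_comp_lift {F φ : ℝ → ℝ} {c : ℝ} (hF : Continuous F)
    (hper : Function.Periodic F c) (hφ : ContDiff ℝ 1 φ) (hl : ∀ x, φ (x + c) = φ x + c) :
    ∫ x in (0 : ℝ)..c, F x = ∫ x in (0 : ℝ)..c, F (φ x) * deriv φ x := by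
  have hsub := intervalIntegral.integral_comp_mul_deriv (a := 0) (b := c) (f := φ)
    (f' := deriv φ) (g := F)
    (fun x _ => (hφ.differentiable one_ne_zero x).hasDerivAt)
    (hφ.continuous_deriv le_rfl).continuousOn hF
  have hc : φ c = φ 0 + c := by simpa using hl 0
  rw [hc, hper.intervalIntegral_add_eq (φ 0) 0, zero_add] at hsub
  exact hsub.symm

/-- The derivative of a `C²` function of a real variable is `C¹`. -/
theorem ContDiff.deriv_of_two {f : ℝ → ℝ} (h : ContDiff ℝ 2 f) : ContDiff ℝ 1 (deriv f) := by
  rw [← one_add_one_eq_two] at h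
  exact h.deriv'

/-- The integrand of the Bott–Thurston cocycle is continuous. -/
theorem continuous_bottThurston_integrand {φ ψ : ℝ → ℝ} (hφ : ContDiff ℝ 2 φ)
    (hψ : ContDiff ℝ 2 ψ) (hφ' : ∀ x, 0 < deriv φ x) (hψ' : ∀ x, 0 < deriv ψ x) :
    Continuous fun x => Real.log (deriv (φ ∘ ψ) x) * (deriv (deriv ψ) x / deriv ψ x) := by
  have hd : ∀ x, deriv (φ ∘ ψ) x = deriv φ (ψ x) * deriv ψ x := fun x =>
    deriv_comp x (hφ.differentiable two_ne_zero _) (hψ.differentiable two_ne_zero _)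
  have h1 : Continuous (deriv (φ ∘ ψ)) := (hφ.comp hψ).continuous_deriv one_le_two
  have h2 : Continuous (deriv ψ) := hψ.continuous_deriv one_le_two
  have h3 : Continuous (deriv (deriv ψ)) :=
    (hψ.deriv_of_two).continuous_deriv le_rfl
  refine (h1.log fun x => ?_).mul (h3.div h2 fun x => (hψ' x).ne')
  rw [hd]
  exact (mul_pos (hφ' _) (hψ' _)).ne'

/-- The Bott–Thurston cocycle satisfies the group 2-cocycle identity
`BT(φ₁,φ₂) + BT(φ₁∘φ₂, φ₃) = BT(φ₂,φ₃) + BT(φ₁, φ₂∘φ₃)`; equivalently, the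
Virasoro group multiplication `(φ₁,t₁)·(φ₂,t₂) = (φ₁∘φ₂, t₁+t₂+BT(φ₁,φ₂))` is
associative. -/
theorem bottThurston_cocycle (φ₁ φ₂ φ₃ : ℝ → ℝ)
    (h₁ : ContDiff ℝ (⊤ : ℕ∞) φ₁) (h₂ : ContDiff ℝ (⊤ : ℕ∞) φ₂) (h₃ : ContDiff ℝ (⊤ : ℕ∞) φ₃)
    (h₁' : ∀ θ, 0 < deriv φ₁ θ) (h₂' : ∀ θ, 0 < deriv φ₂ θ) (h₃' : ∀ θ, 0 < deriv φ₃ θ)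
    (hl₁ : ∀ θ, φ₁ (θ + 2 * Real.pi) = φ₁ θ + 2 * Real.pi)
    (hl₂ : ∀ θ, φ₂ (θ + 2 * Real.pi) = φ₂ θ + 2 * Real.pi)
    (hl₃ : ∀ θ, φ₃ (θ + 2 * Real.pi) = φ₃ θ + 2 * Real.pi) :
    bottThurston φ₁ φ₂ + bottThurston (φ₁ ∘ φ₂) φ₃
      = bottThurston φ₂ φ₃ + bottThurston φ₁ (φ₂ ∘ φ₃) := by
  have le2 : (2 : WithTop ℕ∞) ≤ ((⊤ : ℕ∞) : WithTop ℕ∞) :=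
    WithTop.coe_le_coe.2 le_top
  have c₁ := h₁.of_le le2
  have c₂ := h₂.of_le le2
  have c₃ := h₃.of_le le2
  have d₁ := c₁.differentiable two_ne_zero
  have d₂ := c₂.differentiable two_ne_zero
  have d₃ := c₃.differentiable two_ne_zero
  have dd₂ : Differentiable ℝ (deriv φ₂) := (c₂.deriv_of_two).differentiable one_ne_zero
  have dd₃ : Differentiable ℝ (deriv φ₃) := (c₃.deriv_of_two).differentiable one_ne_zero
  have e₁₂ : deriv (φ₁ ∘ φ₂) = fun x => deriv φ₁ (φ₂ x) * deriv φ₂ x :=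
    funext fun x => deriv_comp x (d₁ _) (d₂ _)
  have e₂₃ : deriv (φ₂ ∘ φ₃) = fun x => deriv φ₂ (φ₃ x) * deriv φ₃ x :=
    funext fun x => deriv_comp x (d₂ _) (d₃ _)
  have e₁₂₃ : deriv ((φ₁ ∘ φ₂) ∘ φ₃) =
      fun x => deriv φ₁ (φ₂ (φ₃ x)) * deriv φ₂ (φ₃ x) * deriv φ₃ x := by
    funext x
    rw [deriv_comp x ((d₁.comp d₂) _) (d₃ _), e₁₂]
  have pos₁₂ : ∀ x, 0 < deriv (φ₁ ∘ φ₂) x := fun x => by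
    rw [e₁₂]; exact mul_pos (h₁' _) (h₂' _)
  have pos₂₃ : ∀ x, 0 < deriv (φ₂ ∘ φ₃) x := fun x => by
    rw [e₂₃]; exact mul_pos (h₂' _) (h₃' _)
  have per₁₂ : Function.Periodic (deriv (φ₁ ∘ φ₂)) (2 * Real.pi) :=
    deriv_periodic_of_add fun x => by simp [hl₁, hl₂]
  have per₂ := deriv_periodic_of_add hl₂
  have per₃ := deriv_periodic_of_add hl₃
  have k₁₂ := continuous_bottThurston_integrand c₁ c₂ h₁' h₂'
  have k₁₂₃ := continuous_bottThurston_integrand (c₁.comp c₂) c₃ pos₁₂ h₃'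
  have k₂₃ := continuous_bottThurston_integrand c₂ c₃ h₂' h₃'
  have k₁₂₃' := continuous_bottThurston_integrand c₁ (c₂.comp c₃) h₁' pos₂₃
  have perF : Function.Periodic (fun x => Real.log (deriv (φ₁ ∘ φ₂) x) *
      (deriv (deriv φ₂) x / deriv φ₂ x)) (2 * Real.pi) := fun x => by
    simp only [per₁₂ x, per₂ x, per₂.deriv_real x]
  have k₃ : Continuous (deriv φ₃) := dd₃.continuous
  have kI : Continuous fun x => Real.log (deriv (φ₁ ∘ φ₂) (φ₃ x)) *
      (deriv (deriv φ₂) (φ₃ x) / deriv φ₂ (φ₃ x)) * deriv φ₃ x :=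
    (k₁₂.comp c₃.continuous).mul k₃
  have hG : ∀ x, HasDerivAt
      (fun x => Real.log (deriv φ₂ (φ₃ x)) * Real.log (deriv φ₃ x)
        + Real.log (deriv φ₃ x) ^ 2 / 2)
      ((Real.log (deriv (φ₂ ∘ φ₃) x) * (deriv (deriv φ₃) x / deriv φ₃ x)
        + Real.log (deriv (φ₁ ∘ (φ₂ ∘ φ₃)) x)
          * (deriv (deriv (φ₂ ∘ φ₃)) x / deriv (φ₂ ∘ φ₃) x))
        - (Real.log (deriv (φ₁ ∘ φ₂) (φ₃ x)) *
            (deriv (deriv φ₂) (φ₃ x) / deriv φ₂ (φ₃ x)) * deriv φ₃ x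
          + Real.log (deriv ((φ₁ ∘ φ₂) ∘ φ₃) x)
            * (deriv (deriv φ₃) x / deriv φ₃ x))) x := by
    intro x
    have n₁ := (h₁' (φ₂ (φ₃ x))).ne'
    have n₂ := (h₂' (φ₃ x)).ne'
    have n₃ := (h₃' x).ne'
    have hb : HasDerivAt (fun x => deriv φ₂ (φ₃ x)) (deriv (deriv φ₂) (φ₃ x) * deriv φ₃ x) x :=
      (dd₂ _).hasDerivAt.comp x (d₃ x).hasDerivAt
    have hc : HasDerivAt (deriv φ₃) (deriv (deriv φ₃) x) x := (dd₃ x).hasDerivAt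
    have e₂₃' : deriv (deriv (φ₂ ∘ φ₃)) x =
        deriv (deriv φ₂) (φ₃ x) * deriv φ₃ x * deriv φ₃ x
          + deriv φ₂ (φ₃ x) * deriv (deriv φ₃) x := by
      rw [e₂₃]; exact (hb.mul hc).deriv
    refine (((hb.log n₂).mul (hc.log n₃)).add (((hc.log n₃).pow 2).div_const 2)).congr_deriv ?_
    rw [← Function.comp_assoc, e₂₃', e₁₂₃, e₁₂, e₂₃]
    simp only []
    rw [Real.log_mul (mul_ne_zero n₁ n₂) n₃, Real.log_mul n₁ n₂, Real.log_mul n₂ n₃]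
    field_simp
    ring
  have key := intervalIntegral.integral_eq_sub_of_hasDerivAt (a := 0) (b := 2 * Real.pi)
    (fun x _ => hG x) (((k₂₃.add k₁₂₃').sub (kI.add k₁₂₃)).intervalIntegrable _ _)
  have hper0 : deriv φ₃ (2 * Real.pi) = deriv φ₃ 0 := per₃.eq
  have hφ0 : φ₃ (2 * Real.pi) = φ₃ 0 + 2 * Real.pi := by simpa using hl₃ 0
  rw [hper0, hφ0, per₂ (φ₃ 0), sub_self,
    intervalIntegral.integral_sub ((k₂₃.fun_add k₁₂₃').intervalIntegrable _ _)
      ((kI.fun_add k₁₂₃).intervalIntegrable _ _),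
    intervalIntegral.integral_add (k₂₃.intervalIntegrable _ _) (k₁₂₃'.intervalIntegrable _ _),
    intervalIntegral.integral_add (kI.intervalIntegrable _ _) (k₁₂₃.intervalIntegrable _ _),
    ← intervalIntegral_periodic_comp_lift k₁₂ perF (c₃.of_le one_le_two) hl₃] at key
  unfold bottThurston
  linarith
end
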